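/- None of the enriched matrices D_0, D_2, D_3, D_7, D_11 admits an LR-ordering; consequently, no LR-orderable enriched matrix contains any of D_0, D_2, D_3, D_7, D_11, or their dual matrices, as a subconfiguration. -/

import Mathlib

/-- Labels for rows of an enriched matrix. -/
inductive RowLabel : Type
  | L | R | LR
deriving DecidableEq

/-- Colors for rows/blocks of an enriched matrix. -/
inductive RowColor : Type
  | red | blue
deriving DecidableEq

/-- An enriched matrix: a (0,1)-matrix whose rows may carry an optional label in
{L, R, LR} and an optional color in {red, blue}, where only L-rows, R-rows and
all-zero LR-rows may be colored, and all colored all-zero LR-rows have the same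
color. -/
structure EnrichedMatrix (m n : ℕ) : Type where
  entry : Fin m → Fin n → Bool
  label : Fin m → Option RowLabel
  color : Fin m → Option RowColor
  color_rows : ∀ i, (color i).isSome = true →
    label i = some RowLabel.L ∨ label i = some RowLabel.R ∨
      (label i = some RowLabel.LR ∧ ∀ j, entry i j = false)
  lr_color_unique : ∀ i k, label i = some RowLabel.LR → label k = some RowLabel.LR →
    (color i).isSome = true → (color k).isSome = true → color i = color k

namespace EnrichedMatrix

variable {m n : ℕ} (A : EnrichedMatrix m n)

/-- Two rows are disjoint: they share no 1-column. -/
def RowDisj (i k : Fin m) : Prop := ∀ j, ¬(A.entry i j = true ∧ A.entry k j = true)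

/-- Row `i` is contained in row `k`. -/
def RowLe (i k : Fin m) : Prop := ∀ j, A.entry i j = true → A.entry k j = true

/-- Two rows are nested: one is contained in the other. -/
def RowNested (i k : Fin m) : Prop := A.RowLe i k ∨ A.RowLe k i

/-- A row is nonempty: it has at least one 1. -/
def RowNonempty (i : Fin m) : Prop := ∃ j, A.entry i j = true

/-- Rows `i` and `k` are both colored, with the same color. -/
def SameColor (i k : Fin m) : Prop := ∃ c, A.color i = some c ∧ A.color k = some c

/-- Rows `i` and `k` are both colored, with distinct colors. -/
def DistinctColors (i k : Fin m) : Prop :=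
  ∃ c d, A.color i = some c ∧ A.color k = some d ∧ c ≠ d

end EnrichedMatrix
namespace EnrichedMatrix

variable {m n : ℕ}

/-- `σ` is an LR-ordering of the columns of `A`: under the column order `σ 0, σ 1, …`,
the 1s of every non-LR-row are consecutive, the 1s of every L-row form an initial
segment, the 1s of every R-row form a final segment, and the 0s of every LR-row are
consecutive. -/
def IsLROrdering (A : EnrichedMatrix m n) (σ : Equiv.Perm (Fin n)) : Prop :=
  (∀ i, A.label i ≠ some RowLabel.LR → ∀ a b c : Fin n, a ≤ b → b ≤ c →
      A.entry i (σ a) = true → A.entry i (σ c) = true → A.entry i (σ b) = true) ∧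
  (∀ i, A.label i = some RowLabel.L → ∀ p q : Fin n, q ≤ p →
      A.entry i (σ p) = true → A.entry i (σ q) = true) ∧
  (∀ i, A.label i = some RowLabel.R → ∀ p q : Fin n, p ≤ q →
      A.entry i (σ p) = true → A.entry i (σ q) = true) ∧
  (∀ i, A.label i = some RowLabel.LR → ∀ a b c : Fin n, a ≤ b → b ≤ c →
      A.entry i (σ a) = false → A.entry i (σ c) = false → A.entry i (σ b) = false)

/-- `A` admits an LR-ordering. -/
def LROrderable (A : EnrichedMatrix m n) : Prop := ∃ σ : Equiv.Perm (Fin n), A.IsLROrdering σ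

/-- Position `p` (w.r.t. the column ordering `σ`) belongs to the L-block of row `i`:
row `i` has 1s in all positions up to and including `p`. -/
def InLBlock (A : EnrichedMatrix m n) (σ : Equiv.Perm (Fin n)) (i : Fin m) (p : Fin n) : Prop :=
  ∀ q : Fin n, q ≤ p → A.entry i (σ q) = true

/-- Position `p` (w.r.t. the column ordering `σ`) belongs to the R-block of row `i`:
row `i` has 1s in all positions from `p` on. -/
def InRBlock (A : EnrichedMatrix m n) (σ : Equiv.Perm (Fin n)) (i : Fin m) (p : Fin n) : Prop :=
  ∀ q : Fin n, p ≤ q → A.entry i (σ q) = true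

/-- Position `p` belongs to the U-block of row `i`: row `i` has a 1 there. -/
def InUBlock (A : EnrichedMatrix m n) (σ : Equiv.Perm (Fin n)) (i : Fin m) (p : Fin n) : Prop :=
  A.entry i (σ p) = true

/-- Row `i` (labeled L or LR) has an L-block w.r.t. `σ`. -/
def HasLBlock (A : EnrichedMatrix m n) (σ : Equiv.Perm (Fin n)) (i : Fin m) : Prop :=
  (A.label i = some RowLabel.L ∨ A.label i = some RowLabel.LR) ∧ ∃ p, A.InLBlock σ i p

/-- Row `i` (labeled R or LR) has an R-block w.r.t. `σ`. -/
def HasRBlock (A : EnrichedMatrix m n) (σ : Equiv.Perm (Fin n)) (i : Fin m) : Prop :=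
  (A.label i = some RowLabel.R ∨ A.label i = some RowLabel.LR) ∧ ∃ p, A.InRBlock σ i p

/-- The LR-ordering `σ` of `A` is suitable: the L-block of each LR-row having exactly
two blocks is disjoint from every R-block, the R-block of each LR-row having exactly
two blocks is disjoint from every L-block, and for each LR-row every U-block is
disjoint from its L-block or disjoint from its R-block. -/
def SuitableLROrdering (A : EnrichedMatrix m n) (σ : Equiv.Perm (Fin n)) : Prop :=
  A.IsLROrdering σ ∧
  (∀ i, A.label i = some RowLabel.LR → A.HasLBlock σ i → A.HasRBlock σ i →
      (∃ p, A.entry i (σ p) = false) →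
      (∀ k, (A.label k = some RowLabel.R ∨ A.label k = some RowLabel.LR) →
        ∀ p, ¬(A.InLBlock σ i p ∧ A.InRBlock σ k p)) ∧
      (∀ k, (A.label k = some RowLabel.L ∨ A.label k = some RowLabel.LR) →
        ∀ p, ¬(A.InRBlock σ i p ∧ A.InLBlock σ k p))) ∧
  (∀ i, A.label i = some RowLabel.LR → ∀ k, A.label k = none →
      (∀ p, ¬(A.InLBlock σ i p ∧ A.InUBlock σ k p)) ∨
      (∀ p, ¬(A.InRBlock σ i p ∧ A.InUBlock σ k p)))

end EnrichedMatrix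

namespace EnrichedMatrix

/-- `D` is (an instance, with any colors, of) the enriched matrix `D_0`. -/
def IsD0 (D : EnrichedMatrix 2 2) : Prop :=
  D.entry 0 0 = true ∧ D.entry 0 1 = false ∧ D.entry 1 0 = false ∧ D.entry 1 1 = true ∧
  D.label 0 = some RowLabel.L ∧ D.label 1 = some RowLabel.L

/-- `D` is (an instance of) the enriched matrix `D_2`. -/
def IsD2 (D : EnrichedMatrix 2 2) : Prop :=
  D.entry 0 0 = true ∧ D.entry 0 1 = false ∧ D.entry 1 0 = true ∧ D.entry 1 1 = false ∧
  D.label 0 = some RowLabel.L ∧ D.label 1 = some RowLabel.R ∧ D.DistinctColors 0 1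

/-- `D` is (an instance of) the enriched matrix `D_3`. -/
def IsD3 (D : EnrichedMatrix 3 3) : Prop :=
  (∀ i j : Fin 3, D.entry i j = true ↔
      ((i = 0 ∧ j = 0) ∨ (i = 1 ∧ j = 2) ∨ (i = 2 ∧ j = 1))) ∧
  D.label 0 = some RowLabel.L ∧ D.label 1 = some RowLabel.R ∧
  D.label 2 = some RowLabel.LR ∧ D.DistinctColors 0 1 ∧ D.color 2 = none

/-- `D` is (an instance, with any color on the first row, of) the enriched matrix
`D_7`. -/
def IsD7 (D : EnrichedMatrix 3 3) : Prop :=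
  (∀ i j : Fin 3, D.entry i j = true ↔ i = j) ∧
  D.label 0 = some RowLabel.L ∧
  D.label 1 = some RowLabel.LR ∧ D.color 1 = none ∧
  D.label 2 = some RowLabel.LR ∧ D.color 2 = none

/-- `D` is (an instance of) the enriched matrix `D_11`. -/
def IsD11 (D : EnrichedMatrix 3 3) : Prop :=
  (∀ i j : Fin 3, D.entry i j = true ↔ i = j) ∧
  (∀ i : Fin 3, D.label i = some RowLabel.LR ∧ D.color i = none)

/-- `A` contains `D_0` (for `ℓ = L`) or its dual (for `ℓ = R`) as a subconfiguration. -/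
def ContainsD0 {m n : ℕ} (A : EnrichedMatrix m n) (ℓ : RowLabel) : Prop :=
  ∃ (i₁ i₂ : Fin m) (j₁ j₂ : Fin n), i₁ ≠ i₂ ∧ j₁ ≠ j₂ ∧
    A.label i₁ = some ℓ ∧ A.label i₂ = some ℓ ∧
    A.entry i₁ j₁ = true ∧ A.entry i₁ j₂ = false ∧
    A.entry i₂ j₁ = false ∧ A.entry i₂ j₂ = true

/-- `A` contains `D_2` (or, equivalently up to permutations, its dual) as a
subconfiguration. -/
def ContainsD2 {m n : ℕ} (A : EnrichedMatrix m n) : Prop :=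
  ∃ (i₁ i₂ : Fin m) (j₁ j₂ : Fin n), j₁ ≠ j₂ ∧
    A.label i₁ = some RowLabel.L ∧ A.label i₂ = some RowLabel.R ∧
    A.DistinctColors i₁ i₂ ∧
    A.entry i₁ j₁ = true ∧ A.entry i₁ j₂ = false ∧
    A.entry i₂ j₁ = true ∧ A.entry i₂ j₂ = false

/-- `A` contains `D_3` (or, equivalently up to permutations, its dual) as a
subconfiguration. -/
def ContainsD3 {m n : ℕ} (A : EnrichedMatrix m n) : Prop :=
  ∃ (i₁ i₂ i₃ : Fin m) (j₁ j₂ j₃ : Fin n), j₁ ≠ j₂ ∧ j₁ ≠ j₃ ∧ j₂ ≠ j₃ ∧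
    A.label i₁ = some RowLabel.L ∧ A.label i₂ = some RowLabel.R ∧
    A.label i₃ = some RowLabel.LR ∧ A.DistinctColors i₁ i₂ ∧ A.color i₃ = none ∧
    A.entry i₁ j₁ = true ∧ A.entry i₁ j₂ = false ∧ A.entry i₁ j₃ = false ∧
    A.entry i₂ j₁ = false ∧ A.entry i₂ j₂ = false ∧ A.entry i₂ j₃ = true ∧
    A.entry i₃ j₁ = false ∧ A.entry i₃ j₂ = true ∧ A.entry i₃ j₃ = false

/-- `A` contains `D_7` (for `ℓ = L`) or its dual (for `ℓ = R`) as a subconfiguration. -/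
def ContainsD7 {m n : ℕ} (A : EnrichedMatrix m n) (ℓ : RowLabel) : Prop :=
  ∃ (a b c : Fin m) (j₁ j₂ j₃ : Fin n), b ≠ c ∧ j₁ ≠ j₂ ∧ j₁ ≠ j₃ ∧ j₂ ≠ j₃ ∧
    A.label a = some ℓ ∧
    A.label b = some RowLabel.LR ∧ A.color b = none ∧
    A.label c = some RowLabel.LR ∧ A.color c = none ∧
    A.entry a j₁ = true ∧ A.entry a j₂ = false ∧ A.entry a j₃ = false ∧
    A.entry b j₁ = false ∧ A.entry b j₂ = true ∧ A.entry b j₃ = false ∧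
    A.entry c j₁ = false ∧ A.entry c j₂ = false ∧ A.entry c j₃ = true

/-- `A` contains `D_11` as a subconfiguration. -/
def ContainsD11 {m n : ℕ} (A : EnrichedMatrix m n) : Prop :=
  ∃ (a b c : Fin m) (j₁ j₂ j₃ : Fin n), a ≠ b ∧ a ≠ c ∧ b ≠ c ∧
    j₁ ≠ j₂ ∧ j₁ ≠ j₃ ∧ j₂ ≠ j₃ ∧
    A.label a = some RowLabel.LR ∧ A.color a = none ∧
    A.label b = some RowLabel.LR ∧ A.color b = none ∧
    A.label c = some RowLabel.LR ∧ A.color c = none ∧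
    A.entry a j₁ = true ∧ A.entry a j₂ = false ∧ A.entry a j₃ = false ∧
    A.entry b j₁ = false ∧ A.entry b j₂ = true ∧ A.entry b j₃ = false ∧
    A.entry c j₁ = false ∧ A.entry c j₂ = false ∧ A.entry c j₃ = true

end EnrichedMatrix

namespace EnrichedMatrix

variable {m n : ℕ} {A : EnrichedMatrix m n} {σ : Equiv.Perm (Fin n)}

/-- In an LR-ordering, the 1s of an L-row precede its 0s. -/
theorem IsLROrdering.lt_of_label_L (h : A.IsLROrdering σ) {i : Fin m} {j k : Fin n}
    (hi : A.label i = some RowLabel.L) (hj : A.entry i j = true) (hk : A.entry i k = false) :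
    σ.symm j < σ.symm k := by
  by_contra! hle
  have := h.2.1 i hi _ _ hle
  simp_all

/-- In an LR-ordering, the 1s of an R-row follow its 0s. -/
theorem IsLROrdering.lt_of_label_R (h : A.IsLROrdering σ) {i : Fin m} {j k : Fin n}
    (hi : A.label i = some RowLabel.R) (hj : A.entry i j = true) (hk : A.entry i k = false) :
    σ.symm k < σ.symm j := by
  by_contra! hle
  have := h.2.2.1 i hi _ _ hle
  simp_all

/-- In an LR-ordering, no 1 of an LR-row lies between two of its 0s. -/
theorem IsLROrdering.not_between_of_label_LR (h : A.IsLROrdering σ) {i : Fin m} {j k l : Fin n}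
    (hi : A.label i = some RowLabel.LR) (hj : A.entry i j = false) (hk : A.entry i k = true)
    (hl : A.entry i l = false) : ¬ (σ.symm j ≤ σ.symm k ∧ σ.symm k ≤ σ.symm l) := by
  rintro ⟨hjk, hkl⟩
  have := h.2.2.2 i hi _ _ _ hjk hkl
  simp_all

theorem LROrderable.not_containsD0_L (hA : A.LROrderable) : ¬ A.ContainsD0 RowLabel.L := by
  obtain ⟨σ, h⟩ := hA
  rintro ⟨i₁, i₂, j₁, j₂, -, -, l₁, l₂, e₁₁, e₁₂, e₂₁, e₂₂⟩
  exact lt_asymm (h.lt_of_label_L l₁ e₁₁ e₁₂) (h.lt_of_label_L l₂ e₂₂ e₂₁)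

theorem LROrderable.not_containsD0_R (hA : A.LROrderable) : ¬ A.ContainsD0 RowLabel.R := by
  obtain ⟨σ, h⟩ := hA
  rintro ⟨i₁, i₂, j₁, j₂, -, -, l₁, l₂, e₁₁, e₁₂, e₂₁, e₂₂⟩
  exact lt_asymm (h.lt_of_label_R l₁ e₁₁ e₁₂) (h.lt_of_label_R l₂ e₂₂ e₂₁)

theorem LROrderable.not_containsD2 (hA : A.LROrderable) : ¬ A.ContainsD2 := by
  obtain ⟨σ, h⟩ := hA
  rintro ⟨i₁, i₂, j₁, j₂, -, l₁, l₂, -, e₁₁, e₁₂, e₂₁, e₂₂⟩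
  exact lt_asymm (h.lt_of_label_L l₁ e₁₁ e₁₂) (h.lt_of_label_R l₂ e₂₁ e₂₂)

theorem LROrderable.not_containsD3 (hA : A.LROrderable) : ¬ A.ContainsD3 := by
  obtain ⟨σ, h⟩ := hA
  rintro ⟨i₁, i₂, i₃, j₁, j₂, j₃, -, -, -, l₁, l₂, l₃, -, -, e₁₁, e₁₂, -, -, e₂₂, e₂₃,
    e₃₁, e₃₂, e₃₃⟩
  exact h.not_between_of_label_LR l₃ e₃₁ e₃₂ e₃₃
    ⟨(h.lt_of_label_L l₁ e₁₁ e₁₂).le, (h.lt_of_label_R l₂ e₂₃ e₂₂).le⟩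

theorem LROrderable.not_containsD7_L (hA : A.LROrderable) : ¬ A.ContainsD7 RowLabel.L := by
  obtain ⟨σ, h⟩ := hA
  rintro ⟨a, b, c, j₁, j₂, j₃, -, -, -, -, la, lb, -, lc, -, a₁, a₂, a₃, b₁, b₂, b₃, c₁, c₂, c₃⟩
  have h₁₂ := (h.lt_of_label_L la a₁ a₂).le
  have h₁₃ := (h.lt_of_label_L la a₁ a₃).le
  rcases le_total (σ.symm j₂) (σ.symm j₃) with h₂₃ | h₃₂
  · exact h.not_between_of_label_LR lb b₁ b₂ b₃ ⟨h₁₂, h₂₃⟩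
  · exact h.not_between_of_label_LR lc c₁ c₃ c₂ ⟨h₁₃, h₃₂⟩

theorem LROrderable.not_containsD7_R (hA : A.LROrderable) : ¬ A.ContainsD7 RowLabel.R := by
  obtain ⟨σ, h⟩ := hA
  rintro ⟨a, b, c, j₁, j₂, j₃, -, -, -, -, la, lb, -, lc, -, a₁, a₂, a₃, b₁, b₂, b₃, c₁, c₂, c₃⟩
  have h₂₁ := (h.lt_of_label_R la a₁ a₂).le
  have h₃₁ := (h.lt_of_label_R la a₁ a₃).le
  rcases le_total (σ.symm j₂) (σ.symm j₃) with h₂₃ | h₃₂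
  · exact h.not_between_of_label_LR lc c₂ c₃ c₁ ⟨h₂₃, h₃₁⟩
  · exact h.not_between_of_label_LR lb b₃ b₂ b₁ ⟨h₃₂, h₂₁⟩

theorem LROrderable.not_containsD11 (hA : A.LROrderable) : ¬ A.ContainsD11 := by
  obtain ⟨σ, h⟩ := hA
  rintro ⟨a, b, c, j₁, j₂, j₃, -, -, -, -, -, -, la, -, lb, -, lc, -,
    a₁, a₂, a₃, b₁, b₂, b₃, c₁, c₂, c₃⟩
  have ha := h.not_between_of_label_LR la a₂ a₁ a₃
  have ha' := h.not_between_of_label_LR la a₃ a₁ a₂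
  have hb := h.not_between_of_label_LR lb b₁ b₂ b₃
  have hb' := h.not_between_of_label_LR lb b₃ b₂ b₁
  have hc := h.not_between_of_label_LR lc c₁ c₃ c₂
  have hc' := h.not_between_of_label_LR lc c₂ c₃ c₁
  omega

theorem IsD0.containsD0 {D : EnrichedMatrix 2 2} (hD : D.IsD0) : D.ContainsD0 RowLabel.L := by
  obtain ⟨e₁₁, e₁₂, e₂₁, e₂₂, l₁, l₂⟩ := hD
  exact ⟨0, 1, 0, 1, by decide, by decide, l₁, l₂, e₁₁, e₁₂, e₂₁, e₂₂⟩

theorem IsD2.containsD2 {D : EnrichedMatrix 2 2} (hD : D.IsD2) : D.ContainsD2 := by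
  obtain ⟨e₁₁, e₁₂, e₂₁, e₂₂, l₁, l₂, hc⟩ := hD
  exact ⟨0, 1, 0, 1, by decide, l₁, l₂, hc, e₁₁, e₁₂, e₂₁, e₂₂⟩

theorem IsD3.containsD3 {D : EnrichedMatrix 3 3} (hD : D.IsD3) : D.ContainsD3 := by
  obtain ⟨he, l₁, l₂, l₃, hc, hn⟩ := hD
  refine ⟨0, 1, 2, 0, 1, 2, by decide, by decide, by decide, l₁, l₂, l₃, hc, hn, ?_⟩
  simp [← Bool.not_eq_true, he]

theorem IsD7.containsD7 {D : EnrichedMatrix 3 3} (hD : D.IsD7) : D.ContainsD7 RowLabel.L := by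
  obtain ⟨he, l₁, l₂, hn₂, l₃, hn₃⟩ := hD
  refine ⟨0, 1, 2, 0, 1, 2, by decide, by decide, by decide, by decide,
    l₁, l₂, hn₂, l₃, hn₃, ?_⟩
  simp [← Bool.not_eq_true, he]

theorem IsD11.containsD11 {D : EnrichedMatrix 3 3} (hD : D.IsD11) : D.ContainsD11 := by
  obtain ⟨he, hl⟩ := hD
  refine ⟨0, 1, 2, 0, 1, 2, by decide, by decide, by decide, by decide, by decide, by decide,
    (hl 0).1, (hl 0).2, (hl 1).1, (hl 1).2, (hl 2).1, (hl 2).2, ?_⟩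
  simp [← Bool.not_eq_true, he]

end EnrichedMatrix

/-- None of `D_0`, `D_2`, `D_3`, `D_7`, `D_11` admits an LR-ordering; consequently, no
LR-orderable enriched matrix contains any of them, or their duals, as a
subconfiguration. -/
theorem D_matrices_not_LROrderable :
    ((∀ D : EnrichedMatrix 2 2, D.IsD0 → ¬ D.LROrderable) ∧
     (∀ D : EnrichedMatrix 2 2, D.IsD2 → ¬ D.LROrderable) ∧
     (∀ D : EnrichedMatrix 3 3, D.IsD3 → ¬ D.LROrderable) ∧
     (∀ D : EnrichedMatrix 3 3, D.IsD7 → ¬ D.LROrderable) ∧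
     (∀ D : EnrichedMatrix 3 3, D.IsD11 → ¬ D.LROrderable)) ∧
    (∀ (m n : ℕ) (A : EnrichedMatrix m n), A.LROrderable →
      ¬ A.ContainsD0 RowLabel.L ∧ ¬ A.ContainsD0 RowLabel.R ∧
      ¬ A.ContainsD2 ∧ ¬ A.ContainsD3 ∧
      ¬ A.ContainsD7 RowLabel.L ∧ ¬ A.ContainsD7 RowLabel.R ∧
      ¬ A.ContainsD11) := by
  exact ⟨⟨fun _ hD hA => hA.not_containsD0_L hD.containsD0,
    fun _ hD hA => hA.not_containsD2 hD.containsD2,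
    fun _ hD hA => hA.not_containsD3 hD.containsD3,
    fun _ hD hA => hA.not_containsD7_L hD.containsD7,
    fun _ hD hA => hA.not_containsD11 hD.containsD11⟩,
    fun _ _ _ hA => ⟨hA.not_containsD0_L, hA.not_containsD0_R, hA.not_containsD2,
      hA.not_containsD3, hA.not_containsD7_L, hA.not_containsD7_R, hA.not_containsD11⟩⟩
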